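/- Fix a natural number K ≥ 2 and a cost function c : ℕ × ℕ → ℝ. Then for every natural number a, minCost(I(0,a)) = c(0,a), and for all natural numbers l and a, minCost(I(l+1,a)) = min( c(l+1,a), ∑_{i=0}^{K−1} minCost(I(l, K·a+i)) ). In particular, the optimal combination for a grid in layer l+1 is determined by the optimal combinations of its K child grids in layer l. -/

import Mathlib

/-- The `K`-adic interval of level `l` and index `a`:
`I(l,a) = {x : ℕ | a·K^l ≤ x < (a+1)·K^l}`. -/
def kInt (K l a : ℕ) : Finset ℕ := Finset.Ico (a * K ^ l) ((a + 1) * K ^ l)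

/-- `P` is a hierarchical partition of the finite set `R`: the K-adic intervals
indexed by the pairs in `P` are pairwise disjoint and their union is `R`. -/
def IsHierPart (K : ℕ) (P : Finset (ℕ × ℕ)) (R : Finset ℕ) : Prop :=
  (∀ p ∈ P, ∀ q ∈ P, p ≠ q → Disjoint (kInt K p.1 p.2) (kInt K q.1 q.2)) ∧
  P.biUnion (fun p => kInt K p.1 p.2) = R

/-- The cost of a hierarchical partition. -/
def cost (c : ℕ × ℕ → ℝ) (P : Finset (ℕ × ℕ)) : ℝ := ∑ p ∈ P, c p

/-- The minimum cost over all hierarchical partitions of `R` (as an infimum of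
the set of attainable costs; for finite `R` this set is finite and nonempty,
so the infimum is a minimum). -/
noncomputable def minCost (K : ℕ) (c : ℕ × ℕ → ℝ) (R : Finset ℕ) : ℝ :=
  sInf {x : ℝ | ∃ P : Finset (ℕ × ℕ), IsHierPart K P R ∧ cost c P = x}

theorem mem_kInt {K : ℕ} (hK : 0 < K) {l a x : ℕ} : x ∈ kInt K l a ↔ x / K ^ l = a := by
  have h : 0 < K ^ l := pow_pos hK l
  rw [kInt, Finset.mem_Ico, Nat.div_eq_iff h]
  have h' : (a + 1) * K ^ l = a * K ^ l + K ^ l := by ring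
  lia

theorem left_mem_kInt {K : ℕ} (hK : 0 < K) (l a : ℕ) : a * K ^ l ∈ kInt K l a := by
  rw [mem_kInt hK, Nat.mul_div_cancel _ (pow_pos hK l)]

theorem div_pow_of_mem_kInt {K l m a x : ℕ} (hK : 0 < K) (hlm : l ≤ m) (hx : x ∈ kInt K l a) :
    x / K ^ m = a * K ^ l / K ^ m := by
  rw [mem_kInt hK] at hx
  obtain ⟨d, rfl⟩ := Nat.exists_eq_add_of_le hlm
  rw [pow_add, ← Nat.div_div_eq_div_mul, ← Nat.div_div_eq_div_mul, hx,
    Nat.mul_div_cancel _ (pow_pos hK l)]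

theorem IsHierPart.subset {K : ℕ} {P : Finset (ℕ × ℕ)} {R : Finset ℕ} (hP : IsHierPart K P R)
    {p : ℕ × ℕ} (hp : p ∈ P) : kInt K p.1 p.2 ⊆ R :=
  hP.2 ▸ Finset.subset_biUnion_of_mem (fun p => kInt K p.1 p.2) hp

theorem isHierPart_singleton (K l a : ℕ) : IsHierPart K {(l, a)} (kInt K l a) := by
  refine ⟨fun p hp q hq hpq => ?_, by simp⟩
  rw [Finset.mem_singleton] at hp hq
  exact absurd (hp.trans hq.symm) hpq

theorem finite_setOf_isHierPart {K : ℕ} (hK : 2 ≤ K) (R : Finset ℕ) :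
    {P : Finset (ℕ × ℕ) | IsHierPart K P R}.Finite := by
  set N := R.sup id + 2
  refine (Finset.finite_toSet (Finset.range N ×ˢ Finset.range N).powerset).subset fun P hP => ?_
  rw [Finset.mem_coe, Finset.mem_powerset]
  rintro ⟨l, a⟩ hp
  have hpow : l < K ^ l := Nat.lt_pow_self (by lia)
  have hmem : (a + 1) * K ^ l - 1 ∈ kInt K l a := by
    rw [kInt, Finset.mem_Ico]
    have : (a + 1) * K ^ l = a * K ^ l + K ^ l := by ring
    lia
  have hle : (a + 1) * K ^ l - 1 ≤ R.sup id :=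
    Finset.le_sup (f := id) (IsHierPart.subset hP hp hmem)
  have h₁ : K ^ l ≤ (a + 1) * K ^ l := Nat.le_mul_of_pos_left _ (by lia)
  have h₂ : a + 1 ≤ (a + 1) * K ^ l := Nat.le_mul_of_pos_right _ (by lia)
  rw [Finset.mem_product, Finset.mem_range, Finset.mem_range]
  constructor <;> dsimp only <;> lia

theorem finite_costs {K : ℕ} (hK : 2 ≤ K) (c : ℕ × ℕ → ℝ) (R : Finset ℕ) :
    {x : ℝ | ∃ P : Finset (ℕ × ℕ), IsHierPart K P R ∧ cost c P = x}.Finite :=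
  (finite_setOf_isHierPart hK R).image (cost c)

theorem minCost_le {K : ℕ} (hK : 2 ≤ K) (c : ℕ × ℕ → ℝ) {P : Finset (ℕ × ℕ)} {R : Finset ℕ}
    (hP : IsHierPart K P R) : minCost K c R ≤ cost c P :=
  csInf_le (finite_costs hK c R).bddBelow ⟨P, hP, rfl⟩

theorem exists_cost_eq_minCost {K : ℕ} (hK : 2 ≤ K) (c : ℕ × ℕ → ℝ) (l a : ℕ) :
    ∃ P, IsHierPart K P (kInt K l a) ∧ cost c P = minCost K c (kInt K l a) :=
  (finite_costs hK c _).isCompact.sInf_mem ⟨_, _, isHierPart_singleton K l a, rfl⟩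

theorem minCost_le_self {K : ℕ} (hK : 2 ≤ K) (c : ℕ × ℕ → ℝ) (l a : ℕ) :
    minCost K c (kInt K l a) ≤ c (l, a) := by
  simpa [cost] using minCost_le hK c (isHierPart_singleton K l a)

/-- A partition of a K-adic interval is trivial or uses only intervals of strictly lower level. -/
theorem IsHierPart.eq_singleton_or_lt {K : ℕ} (hK : 2 ≤ K) {P : Finset (ℕ × ℕ)} {l a : ℕ}
    (hP : IsHierPart K P (kInt K l a)) : P = {(l, a)} ∨ ∀ p ∈ P, p.1 < l := by
  have hK₀ : 0 < K := by lia
  refine or_iff_not_imp_right.2 fun h => ?_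
  push Not at h
  obtain ⟨p, hp, hlp⟩ := h
  have hsub := hP.subset hp
  have hcard := Finset.card_le_card hsub
  simp only [kInt, Nat.card_Ico, ← Nat.sub_mul, Nat.add_sub_cancel_left, one_mul] at hcard
  have hl : p.1 = l := le_antisymm ((Nat.pow_le_pow_iff_right hK).1 hcard) hlp
  have ha : p.2 = a := by
    have := hsub (left_mem_kInt hK₀ p.1 p.2)
    rwa [mem_kInt hK₀, hl, Nat.mul_div_cancel _ (pow_pos hK₀ l)] at this
  obtain rfl : p = (l, a) := Prod.ext hl ha
  refine Finset.eq_singleton_iff_unique_mem.2 ⟨hp, fun q hq => ?_⟩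
  by_contra hne
  have hmem := left_mem_kInt hK₀ q.1 q.2
  exact Finset.disjoint_left.1 (hP.1 q hq _ hp hne) hmem (hP.subset hq hmem)

theorem IsHierPart.filter_div {K : ℕ} (hK : 0 < K) {P : Finset (ℕ × ℕ)} {R : Finset ℕ} {l : ℕ}
    (hP : IsHierPart K P R) (hl : ∀ p ∈ P, p.1 ≤ l) (j : ℕ) :
    IsHierPart K {p ∈ P | p.2 * K ^ p.1 / K ^ l = j} {x ∈ R | x / K ^ l = j} := by
  refine ⟨fun p hp q hq => hP.1 p (Finset.mem_filter.1 hp).1 q (Finset.mem_filter.1 hq).1, ?_⟩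
  ext x
  simp only [← hP.2, Finset.mem_biUnion, Finset.mem_filter]
  constructor
  · rintro ⟨p, ⟨hp, hj⟩, hx⟩
    exact ⟨⟨p, hp, hx⟩, (div_pow_of_mem_kInt hK (hl p hp) hx).trans hj⟩
  · rintro ⟨⟨p, hp, hx⟩, hj⟩
    exact ⟨p, ⟨hp, (div_pow_of_mem_kInt hK (hl p hp) hx).symm.trans hj⟩, hx⟩

theorem mem_kInt_succ {K : ℕ} (hK : 0 < K) {l a x : ℕ} :
    x ∈ kInt K (l + 1) a ↔ ∃ i < K, x ∈ kInt K l (K * a + i) := by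
  simp only [mem_kInt hK, pow_succ, ← Nat.div_div_eq_div_mul]
  constructor
  · rintro rfl
    exact ⟨_, Nat.mod_lt _ hK, (Nat.div_add_mod _ _).symm⟩
  · rintro ⟨i, hi, h⟩
    rw [h, Nat.mul_add_div hK, Nat.div_eq_of_lt hi, add_zero]

theorem filter_kInt_succ {K : ℕ} (hK : 0 < K) {l a i : ℕ} (hi : i < K) :
    {x ∈ kInt K (l + 1) a | x / K ^ l = K * a + i} = kInt K l (K * a + i) := by
  ext x
  rw [Finset.mem_filter, ← mem_kInt hK, and_iff_right_iff_imp]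
  exact fun hx => (mem_kInt_succ hK).2 ⟨i, hi, hx⟩

theorem sum_minCost_le_cost {K : ℕ} (hK : 2 ≤ K) (c : ℕ × ℕ → ℝ) {P : Finset (ℕ × ℕ)} {l a : ℕ}
    (hP : IsHierPart K P (kInt K (l + 1) a)) (hl : ∀ p ∈ P, p.1 ≤ l) :
    ∑ i ∈ Finset.range K, minCost K c (kInt K l (K * a + i)) ≤ cost c P := by
  have hK₀ : 0 < K := by lia
  have hparent : ∀ p ∈ P, ∃ i < K, p.2 * K ^ p.1 / K ^ l = K * a + i := fun p hp => by
    simpa only [mem_kInt hK₀] using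
      (mem_kInt_succ hK₀).1 (hP.subset hp (left_mem_kInt hK₀ p.1 p.2))
  have hmaps : ∀ p ∈ P, p.2 * K ^ p.1 / K ^ l - K * a ∈ Finset.range K := fun p hp => by
    obtain ⟨i, hi, h⟩ := hparent p hp
    rw [Finset.mem_range]
    lia
  rw [cost, ← Finset.sum_fiberwise_of_maps_to hmaps]
  refine Finset.sum_le_sum fun i hi => ?_
  have hfilter : {p ∈ P | p.2 * K ^ p.1 / K ^ l - K * a = i} =
      {p ∈ P | p.2 * K ^ p.1 / K ^ l = K * a + i} :=
    Finset.filter_congr fun p hp => by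
      obtain ⟨i, hi, h⟩ := hparent p hp
      lia
  have h := hP.filter_div hK₀ hl (K * a + i)
  rw [filter_kInt_succ hK₀ (Finset.mem_range.1 hi)] at h
  rw [hfilter]
  exact minCost_le hK c h

theorem disjoint_kInt {K : ℕ} (hK : 0 < K) {l a b : ℕ} (hab : a ≠ b) :
    Disjoint (kInt K l a) (kInt K l b) :=
  Finset.disjoint_left.2 fun _ hx hy => hab (((mem_kInt hK).1 hx).symm.trans ((mem_kInt hK).1 hy))

theorem minCost_succ_le_sum {K : ℕ} (hK : 2 ≤ K) (c : ℕ × ℕ → ℝ) (l a : ℕ) :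
    minCost K c (kInt K (l + 1) a) ≤
      ∑ i ∈ Finset.range K, minCost K c (kInt K l (K * a + i)) := by
  have hK₀ : 0 < K := by lia
  choose P hP hcost using fun i => exists_cost_eq_minCost hK c l (K * a + i)
  have hdisj : ∀ {i j p q}, i ≠ j → p ∈ P i → q ∈ P j →
      Disjoint (kInt K p.1 p.2) (kInt K q.1 q.2) := fun hij hp hq =>
    (disjoint_kInt hK₀ (by lia)).mono ((hP _).subset hp) ((hP _).subset hq)
  have hunion : IsHierPart K ((Finset.range K).biUnion P) (kInt K (l + 1) a) := by
    refine ⟨fun p hp q hq hpq => ?_, ?_⟩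
    · obtain ⟨i, -, hp⟩ := Finset.mem_biUnion.1 hp
      obtain ⟨j, -, hq⟩ := Finset.mem_biUnion.1 hq
      obtain rfl | hij := eq_or_ne i j
      · exact (hP i).1 p hp q hq hpq
      · exact hdisj hij hp hq
    · ext x
      rw [Finset.biUnion_biUnion, mem_kInt_succ hK₀]
      simp only [(hP _).2, Finset.mem_biUnion, Finset.mem_range]
  have hpairwise : Set.PairwiseDisjoint (Finset.range K : Set ℕ) P := fun i _ j _ hij =>
    Finset.disjoint_left.2 fun p hp hq =>
      Finset.disjoint_left.1 (hdisj hij hp hq) (left_mem_kInt hK₀ _ _) (left_mem_kInt hK₀ _ _)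
  calc minCost K c (kInt K (l + 1) a)
      ≤ cost c ((Finset.range K).biUnion P) := minCost_le hK c hunion
    _ = ∑ i ∈ Finset.range K, cost c (P i) := Finset.sum_biUnion hpairwise
    _ = _ := Finset.sum_congr rfl fun i _ => hcost i

/-- Bellman recurrence (Lemma 4.1 of the paper): `minCost(I(0,a)) = c(0,a)` and
`minCost(I(l+1,a)) = min(c(l+1,a), ∑_{i<K} minCost(I(l, K·a+i)))`: the optimal
combination of a coarse grid is determined by those of its `K` children. -/
theorem minCost_recurrence (K : ℕ) (hK : 2 ≤ K) (c : ℕ × ℕ → ℝ) :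
    (∀ a : ℕ, minCost K c (kInt K 0 a) = c (0, a)) ∧
    (∀ l a : ℕ, minCost K c (kInt K (l + 1) a) =
      min (c (l + 1, a)) (∑ i ∈ Finset.range K, minCost K c (kInt K l (K * a + i)))) := by
  constructor
  · intro a
    obtain ⟨P, hP, hcost⟩ := exists_cost_eq_minCost hK c 0 a
    obtain rfl | h := hP.eq_singleton_or_lt hK
    · simp [← hcost, cost]
    · have hx := left_mem_kInt (by lia : 0 < K) 0 a
      rw [← hP.2, Finset.mem_biUnion] at hx
      obtain ⟨p, hp, -⟩ := hx
      exact absurd (h p hp) (Nat.not_lt_zero _)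
  · intro l a
    refine le_antisymm (le_min (minCost_le_self hK c _ _) (minCost_succ_le_sum hK c l a)) ?_
    obtain ⟨P, hP, hcost⟩ := exists_cost_eq_minCost hK c (l + 1) a
    rw [← hcost]
    obtain rfl | h := hP.eq_singleton_or_lt hK
    · exact (min_le_left _ _).trans_eq (by simp [cost])
    · exact (min_le_right _ _).trans
        (sum_minCost_le_cost hK c hP fun p hp => Nat.lt_succ_iff.1 (h p hp))
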